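/- arXiv:1709.06343 — 2 statements merged into one kernel-verified Lean document; each statement's English description precedes it below -/
import Mathlib

section
/- Let E be a set of Lipschitz Carathéodory functions f : ℝ × ℝ^N → ℝ^N whose optimal m-bounds m_f^j(t) := sup_{|x|≤j} |f(t,x)| form, for each j ∈ ℕ, an L¹_loc-equicontinuous family, and let Θ = {θ_j^I} be the suitable set of moduli of continuity defined by θ_j^I(s) := sup_{t ∈ I, f ∈ E} ∫_t^{t+s} m_f^j(u) du. Let (f_n) be a sequence in E converging in the σ_Θ sense to a Lipschitz Carathéodory function f, and let (x_{0,n}) converge to x₀ in ℝ^N. Let x(·, f, x₀) be the solution of ẋ = f(t,x), x(0) = x₀, and let [T₁, T₂] with T₁ ≤ 0 ≤ T₂ be a compact interval contained in its maximal interval of definition. Then for every ε > 0 there is n₀ such that for all n ≥ n₀ the solution x(·, f_n, x_{0,n}) of ẋ = f_n(t,x), x(0) = x_{0,n} is defined on all of [T₁, T₂] and sup_{t ∈ [T₁,T₂]} |x(t, f_n, x_{0,n}) − x(t, f, x₀)| ≤ ε; that is, x(·, f_n, x_{0,n}) → x(·, f, x₀) uniformly on [T₁, T₂]. -/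
open MeasureTheory Set Filter Topology
open scoped RealInnerProductSpace

noncomputable section

abbrev Euc (n : ℕ) := EuclideanSpace ℝ (Fin n)

/-- A function `ℝ → ℝ` is locally integrable (w.r.t. Lebesgue measure) on every
compact interval. -/
def LocInt (m : ℝ → ℝ) : Prop := ∀ a b : ℝ, IntegrableOn m (Icc a b)

section Defs

variable {N : ℕ} {F : Type*} [NormedAddCommGroup F] [NormedSpace ℝ F]

/-- The Carathéodory conditions (C1) and (C2). -/
def IsCara (f : ℝ → Euc N → F) : Prop :=
  StronglyMeasurable (Function.uncurry f) ∧
  ∀ K : Set (Euc N), IsCompact K → ∃ m : ℝ → ℝ, (∀ t, 0 ≤ m t) ∧ LocInt m ∧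
    ∀ᵐ t : ℝ, ∀ x ∈ K, ‖f t x‖ ≤ m t

/-- A suitable set of moduli of continuity `Θ = {θ_j^{[q₁,q₂]}}`. -/
structure SuitableModuli where
  θ : ℕ → ℚ → ℚ → ℝ → ℝ
  nonneg : ∀ j q₁ q₂ s, (0:ℝ) ≤ s → 0 ≤ θ j q₁ q₂ s
  cont : ∀ j q₁ q₂, ContinuousOn (θ j q₁ q₂) (Ici 0)
  mono : ∀ j q₁ q₂, MonotoneOn (θ j q₁ q₂) (Ici 0)
  zero : ∀ j q₁ q₂, θ j q₁ q₂ 0 = 0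
  ordered : ∀ j₁ j₂ q₁ q₂ p₁ p₂, j₁ ≤ j₂ → p₁ ≤ q₁ → q₂ ≤ p₂ →
    ∀ s : ℝ, 0 ≤ s → θ j₁ q₁ q₂ s ≤ θ j₂ p₁ p₂ s

/-- `x ∈ K_j^{[q₁,q₂]}`: continuous, bounded by `j` and with modulus of continuity
`θ_j^{[q₁,q₂]}` on `[q₁,q₂]`. -/
def inK {N : ℕ} (Θ : SuitableModuli) (j : ℕ) (q₁ q₂ : ℚ) (x : ℝ → Euc N) : Prop :=
  ContinuousOn x (Icc (q₁:ℝ) (q₂:ℝ)) ∧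
  (∀ t ∈ Icc (q₁:ℝ) (q₂:ℝ), ‖x t‖ ≤ (j:ℝ)) ∧
  ∀ t ∈ Icc (q₁:ℝ) (q₂:ℝ), ∀ s ∈ Icc (q₁:ℝ) (q₂:ℝ), ‖x t - x s‖ ≤ Θ.θ j q₁ q₂ |t - s|

/-- Weak Θ-Carathéodory functions: Carathéodory conditions plus condition (W). -/
def IsWTC (Θ : SuitableModuli) (f : ℝ → Euc N → F) : Prop :=
  IsCara f ∧
  ∀ (j : ℕ) (q₁ q₂ : ℚ) (xs : ℕ → ℝ → Euc N) (x : ℝ → Euc N),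
    (∀ n, inK Θ j q₁ q₂ (xs n)) → inK Θ j q₁ q₂ x →
    TendstoUniformlyOn (fun n t => xs n t) x atTop (Icc (q₁:ℝ) (q₂:ℝ)) →
    Tendsto (fun n => ∫ t in Icc (q₁:ℝ) (q₂:ℝ), f t (xs n t)) atTop
      (𝓝 (∫ t in Icc (q₁:ℝ) (q₂:ℝ), f t (x t)))

/-- Convergence in the `σ_Θ` sense:
`sup_{x ∈ K_j^I} ‖∫_I (f_n(t,x(t)) − f(t,x(t))) dt‖ → 0` for every `j` and `I`. -/
def SigmaTendsto (Θ : SuitableModuli) (fs : ℕ → ℝ → Euc N → F) (f : ℝ → Euc N → F) : Prop :=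
  ∀ (j : ℕ) (q₁ q₂ : ℚ), ∀ ε > (0:ℝ), ∀ᶠ n in atTop, ∀ x : ℝ → Euc N, inK Θ j q₁ q₂ x →
    ‖∫ t in Icc (q₁:ℝ) (q₂:ℝ), (fs n t (x t) - f t (x t))‖ < ε

end Defs

/-- Lipschitz Carathéodory functions. -/
def IsLC {N : ℕ} (f : ℝ → Euc N → Euc N) : Prop :=
  IsCara f ∧
  ∀ K : Set (Euc N), IsCompact K → ∃ l : ℝ → ℝ, LocInt l ∧
    ∀ᵐ t : ℝ, ∀ x ∈ K, ∀ y ∈ K, ‖f t x - f t y‖ ≤ l t * ‖x - y‖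

/-- The optimal m-bound of `f` on the closed ball `B_j`. -/
def mOpt {N : ℕ} (f : ℝ → Euc N → Euc N) (j : ℕ) (t : ℝ) : ℝ :=
  sSup {v : ℝ | ∃ x : Euc N, ‖x‖ ≤ (j:ℝ) ∧ v = ‖f t x‖}

/-- The time translation `f_r(s,x) = f(s+r,x)`. -/
def timeTranslate {N : ℕ} (f : ℝ → Euc N → Euc N) (r : ℝ) : ℝ → Euc N → Euc N :=
  fun s x => f (s + r) x

/-- `x` is a solution of `ẋ = g(t,x)`, `x(0) = x₀`, defined on `[0,∞)`. -/
def IsSolOn {N : ℕ} (g : ℝ → Euc N → Euc N) (x₀ : Euc N) (x : ℝ → Euc N) : Prop :=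
  ContinuousOn x (Ici 0) ∧ ∀ t ∈ Ici (0:ℝ), x t = x₀ + ∫ s in (0:ℝ)..t, g s (x s)

section Auxiliary

open scoped Interval

/-- The metric projection onto a closed ball centred at the origin. -/
theorem exists_nonexpansive_retraction_ball {G : Type*} [NormedAddCommGroup G]
    [InnerProductSpace ℝ G] [CompleteSpace G] {r : ℝ} (hr : 0 ≤ r) :
    ∃ P : G → G, (∀ x, ‖P x‖ ≤ r) ∧ (∀ x y, ‖P x - P y‖ ≤ ‖x - y‖) ∧
      ∀ x, ‖x‖ ≤ r → P x = x := by
  have hconv : Convex ℝ (Metric.closedBall (0 : G) r) := convex_closedBall _ _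
  choose P hPmem hP using exists_norm_eq_iInf_of_complete_convex
    (Metric.nonempty_closedBall.2 hr) (Metric.isClosed_closedBall (x := (0 : G))).isComplete hconv
  have hP' := fun x => (norm_eq_iInf_iff_real_inner_le_zero hconv (hPmem x)).1 (hP x)
  refine ⟨P, fun x => by simpa using hPmem x, fun x y => ?_, fun x hx => ?_⟩
  · have h₁ := hP' x (P y) (hPmem y)
    have h₂ := hP' y (P x) (hPmem x)
    have h₃ : ‖P x - P y‖ ^ 2 ≤ inner ℝ (x - y) (P x - P y) := by
      rw [← real_inner_self_eq_norm_sq]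
      have h₄ : inner ℝ (x - P x) (P y - P x) = -inner ℝ (x - P x) (P x - P y) := by
        rw [← inner_neg_right, neg_sub]
      have h₅ : inner ℝ (x - y) (P x - P y) = inner ℝ (x - P x) (P x - P y)
          + inner ℝ (P x - P y) (P x - P y) - inner ℝ (y - P y) (P x - P y) := by
        rw [← inner_add_left, ← inner_sub_left]
        congr 1
        abel
      linarith
    have h₄ := real_inner_le_norm (x - y) (P x - P y)
    by_contra! h
    nlinarith [norm_nonneg (x - y)]
  · have h := hP' x x (by simpa using hx)
    rw [real_inner_self_nonpos, sub_eq_zero] at h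
    exact h.symm

theorem integral_uIoc_exp_mul_abs_le {c : ℝ} (hc : 0 < c) (t : ℝ) :
    ∫ s in Ι 0 t, Real.exp (c * |s|) ≤ Real.exp (c * |t|) / c := by
  have key : ∀ u : ℝ, 0 ≤ u → ∫ s in (0 : ℝ)..u, Real.exp (c * |s|) ≤ Real.exp (c * u) / c := by
    intro u hu
    have h₁ : ∫ s in (0 : ℝ)..u, Real.exp (c * |s|) = ∫ s in (0 : ℝ)..u, Real.exp (c * s) := by
      refine intervalIntegral.integral_congr fun s hs => ?_
      rw [uIcc_of_le hu] at hs
      simp only [abs_of_nonneg hs.1]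
    rw [h₁, intervalIntegral.integral_comp_mul_left _ hc.ne', integral_exp]
    simp only [mul_zero, Real.exp_zero, smul_eq_mul]
    rw [inv_mul_eq_div]
    gcongr
    linarith
  rcases le_total 0 t with ht | ht
  · rw [uIoc_of_le ht, ← intervalIntegral.integral_of_le ht, abs_of_nonneg ht]
    exact key t ht
  · rw [uIoc_of_ge ht, ← intervalIntegral.integral_of_le ht, abs_of_nonpos ht]
    have h₂ := intervalIntegral.integral_comp_neg (a := 0) (b := -t)
      (fun s => Real.exp (c * |s|))
    simp only [abs_neg, neg_neg, neg_zero] at h₂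
    rw [← h₂]
    exact key (-t) (by linarith)

theorem uIoc_zero_abs_le {s t : ℝ} (hs : s ∈ Ι 0 t) : |s| ≤ |t| := by
  rcases le_total 0 t with ht | ht
  · rw [uIoc_of_le ht] at hs
    rw [abs_of_pos hs.1, abs_of_nonneg ht]
    exact hs.2
  · rw [uIoc_of_ge ht] at hs
    rw [abs_of_nonpos hs.2, abs_of_nonpos ht]
    linarith [hs.1]

theorem exists_integral_excess_le {l : ℝ → ℝ} (hl : Integrable l) :
    ∃ M : ℝ, 0 < M ∧ ∫ s, max (l s - M) 0 ≤ 1 / 4 := by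
  have h : Tendsto (fun n : ℕ => ∫ s, max (l s - n) 0) atTop (𝓝 (∫ _ : ℝ, (0 : ℝ))) := by
    refine tendsto_integral_of_dominated_convergence (fun s => |l s|) ?_ hl.abs ?_ ?_
    · intro n
      exact (hl.aestronglyMeasurable.sub aestronglyMeasurable_const).sup
        aestronglyMeasurable_const
    · intro n
      refine Eventually.of_forall fun s => ?_
      rw [Real.norm_of_nonneg (le_max_right _ _)]
      refine max_le ?_ (abs_nonneg _)
      have := le_abs_self (l s)
      have : (0 : ℝ) ≤ n := n.cast_nonneg
      linarith
    · refine Eventually.of_forall fun s => tendsto_const_nhds.congr' ?_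
      filter_upwards [eventually_ge_atTop ⌈l s⌉₊] with n hn
      rw [max_eq_right]
      have := Nat.ceil_le.1 hn
      linarith
  rw [integral_zero] at h
  obtain ⟨n, hn, hn'⟩ := ((h.eventually (gt_mem_nhds (by norm_num : (0 : ℝ) < 1 / 4))).and
    (eventually_gt_atTop 0)).exists
  exact ⟨n, by exact_mod_cast hn', hn.le⟩

theorem MeasureTheory.Integrable.integrableOn_uIoc_mul {l w : ℝ → ℝ} (hl : Integrable l)
    (hw : Continuous w) (a b : ℝ) : IntegrableOn (fun s => l s * w s) (Ι a b) :=
  (hl.integrableOn.mul_continuousOn hw.continuousOn isCompact_uIcc).mono_set uIoc_subset_uIcc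

/-- Exponential weights absorb an integrable kernel: the estimate behind Bielecki norms. -/
theorem exists_exp_weight {l : ℝ → ℝ} (hl : Integrable l) :
    ∃ c : ℝ, 0 < c ∧ ∀ t : ℝ,
      ∫ s in Ι 0 t, l s * Real.exp (c * |s|) ≤ Real.exp (c * |t|) / 2 := by
  obtain ⟨M, hM, hexc⟩ := exists_integral_excess_le hl
  refine ⟨4 * M, by positivity, fun t => ?_⟩
  set w : ℝ → ℝ := fun s => Real.exp (4 * M * |s|) with hw
  have hwc : Continuous w := by fun_prop
  have hwint : IntegrableOn w (Ι 0 t) := hwc.integrableOn_uIoc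
  have hexci : Integrable fun s => max (l s - M) 0 := by
    refine hl.abs.mono' ((hl.aestronglyMeasurable.sub aestronglyMeasurable_const).sup
        aestronglyMeasurable_const) (Eventually.of_forall fun s => ?_)
    rw [Real.norm_of_nonneg (le_max_right _ _)]
    exact max_le (by linarith [le_abs_self (l s)]) (abs_nonneg _)
  have h₁ : ∀ s ∈ Ι 0 t, l s * w s ≤ M * w s + max (l s - M) 0 * w t := by
    intro s hs
    have hst : w s ≤ w t := Real.exp_le_exp.2
      (mul_le_mul_of_nonneg_left (uIoc_zero_abs_le hs) (by positivity))
    have hws : 0 < w s := Real.exp_pos _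
    calc l s * w s = M * w s + (l s - M) * w s := by ring
      _ ≤ M * w s + max (l s - M) 0 * w s := by gcongr; exact le_max_left _ _
      _ ≤ _ := by gcongr
  have hlw : IntegrableOn (fun s => l s * w s) (Ι 0 t) := hl.integrableOn_uIoc_mul hwc 0 t
  calc ∫ s in Ι 0 t, l s * w s
      ≤ ∫ s in Ι 0 t, (M * w s + max (l s - M) 0 * w t) :=
        setIntegral_mono_on hlw ((hwint.const_mul _).add (hexci.integrableOn.mul_const _))
          measurableSet_uIoc h₁
    _ = M * (∫ s in Ι 0 t, w s) + (∫ s in Ι 0 t, max (l s - M) 0) * w t := by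
        rw [integral_add (hwint.const_mul _) (hexci.integrableOn.mul_const _),
          integral_const_mul, integral_mul_const]
    _ ≤ M * (w t / (4 * M)) + 1 / 4 * w t := by
        have hwt : 0 < w t := Real.exp_pos _
        gcongr
        · exact integral_uIoc_exp_mul_abs_le (by positivity) t
        · exact (setIntegral_le_integral hexci
            (Eventually.of_forall fun s => le_max_right _ _)).trans hexc
    _ = w t / 2 := by field_simp; ring

section Existence

variable {G : Type*} [NormedAddCommGroup G] [MeasurableSpace G] [BorelSpace G]

theorem aestronglyMeasurable_comp_graph {F : Type*} [NormedAddCommGroup F] {g : ℝ → G → F}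
    (hg : StronglyMeasurable (Function.uncurry g)) {v : ℝ → G} (hv : Continuous v)
    (μ : Measure ℝ) : AEStronglyMeasurable (fun s => g s (v s)) μ :=
  (hg.comp_measurable (measurable_id.prodMk hv.measurable)).aestronglyMeasurable

variable [NormedSpace ℝ G] [CompleteSpace G]

/-- Global existence for `ẏ = g(t,y)` when `g` has integrable bounds and Lipschitz constants. -/
theorem exists_forall_eq_add_integral {g : ℝ → G → G}
    (hg : StronglyMeasurable (Function.uncurry g)) {m l : ℝ → ℝ} (hm : Integrable m)
    (hl : Integrable l) (hl0 : ∀ t, 0 ≤ l t) (hgm : ∀ᵐ t : ℝ, ∀ x, ‖g t x‖ ≤ m t)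
    (hgl : ∀ᵐ t : ℝ, ∀ x y, ‖g t x - g t y‖ ≤ l t * ‖x - y‖) (y₀ : G) :
    ∃ y : ℝ → G, Continuous y ∧ ∀ t, y t = y₀ + ∫ s in (0 : ℝ)..t, g s (y s) := by
  have hint : ∀ v : ℝ → G, Continuous v → Integrable fun s => g s (v s) := fun v hv =>
    hm.mono' (aestronglyMeasurable_comp_graph hg hv _) (hgm.mono fun s hs => hs _)
  obtain ⟨c, hc, hweight⟩ := exists_exp_weight hl
  set v : BoundedContinuousFunction ℝ G → ℝ → G := fun u s => Real.exp (c * |s|) • u s with hv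
  have hvc : ∀ u, Continuous (v u) := fun u => by
    have := u.continuous
    fun_prop
  set I : BoundedContinuousFunction ℝ G → ℝ → G := fun u t =>
    ∫ s in (0 : ℝ)..t, g s (v u s) with hI
  have hIc : ∀ u, Continuous (I u) := fun u => (hint _ (hvc u)).continuous_primitive 0
  have hIb : ∀ u t, ‖I u t‖ ≤ ∫ s, m s := fun u t => by
    refine intervalIntegral.norm_integral_le_integral_norm_uIoc.trans ?_
    refine (setIntegral_le_integral (hint _ (hvc u)).norm
      (Eventually.of_forall fun s => norm_nonneg _)).trans ?_
    exact integral_mono_ae (hint _ (hvc u)).norm hm (hgm.mono fun s hs => hs _)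
  let Φ : BoundedContinuousFunction ℝ G → BoundedContinuousFunction ℝ G := fun u =>
    BoundedContinuousFunction.ofNormedAddCommGroup
      (fun t => Real.exp (-(c * |t|)) • (y₀ + I u t))
      (by have := hIc u; fun_prop) (‖y₀‖ + ∫ s, m s) (fun t => by
        rw [norm_smul, Real.norm_of_nonneg (Real.exp_pos _).le]
        have h₁ : Real.exp (-(c * |t|)) ≤ 1 := Real.exp_le_one_iff.2 (by
          have := mul_nonneg hc.le (abs_nonneg t)
          linarith)
        calc _ ≤ 1 * ‖y₀ + I u t‖ := by gcongr
          _ ≤ _ := by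
            rw [one_mul]
            exact (norm_add_le _ _).trans (by gcongr; exact hIb u t))
  have hΦ : ContractingWith (1 / 2) Φ := by
    refine ⟨by norm_num, LipschitzWith.of_dist_le_mul fun u u' => ?_⟩
    refine (BoundedContinuousFunction.dist_le (by positivity)).2 fun t => ?_
    have hdiff : ‖I u t - I u' t‖ ≤ Real.exp (c * |t|) / 2 * dist u u' := by
      have hii := fun u => (hint _ (hvc u)).intervalIntegrable (a := 0) (b := t)
      simp only [hI]
      rw [← intervalIntegral.integral_sub (hii u) (hii u')]
      refine intervalIntegral.norm_integral_le_integral_norm_uIoc.trans ?_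
      calc _ ≤ ∫ s in Ι 0 t, l s * Real.exp (c * |s|) * dist u u' := by
            refine integral_mono_ae ((hint _ (hvc u)).sub (hint _ (hvc u'))).norm.integrableOn
              ((hl.integrableOn_uIoc_mul (by fun_prop) 0 t).mul_const _)
              (ae_restrict_of_ae ?_)
            filter_upwards [hgl] with s hs
            have hvv : ‖v u s - v u' s‖ = Real.exp (c * |s|) * dist (u s) (u' s) := by
              simp only [hv]
              rw [← smul_sub, norm_smul, Real.norm_of_nonneg (Real.exp_pos _).le, dist_eq_norm]
            calc _ ≤ l s * ‖v u s - v u' s‖ := hs _ _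
              _ = l s * Real.exp (c * |s|) * dist (u s) (u' s) := by rw [hvv, mul_assoc]
              _ ≤ _ := mul_le_mul_of_nonneg_left
                (BoundedContinuousFunction.dist_coe_le_dist s)
                (mul_nonneg (hl0 s) (Real.exp_pos _).le)
        _ = (∫ s in Ι 0 t, l s * Real.exp (c * |s|)) * dist u u' := integral_mul_const _ _
        _ ≤ _ := by
          gcongr
          exact hweight t
    change dist (Real.exp (-(c * |t|)) • (y₀ + I u t)) (Real.exp (-(c * |t|)) • (y₀ + I u' t)) ≤ _
    rw [dist_eq_norm, ← smul_sub, add_sub_add_left_eq_sub, norm_smul,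
      Real.norm_of_nonneg (Real.exp_pos _).le]
    calc _ ≤ Real.exp (-(c * |t|)) * (Real.exp (c * |t|) / 2 * dist u u') := by gcongr
      _ = Real.exp (-(c * |t|) + c * |t|) / 2 * dist u u' := by rw [Real.exp_add]; ring
      _ = _ := by simp
  obtain ⟨u, hu⟩ : ∃ u, Φ u = u := ⟨_, hΦ.fixedPoint_isFixedPt⟩
  refine ⟨v u, hvc u, fun t => ?_⟩
  have hut : u t = Real.exp (-(c * |t|)) • (y₀ + I u t) := by
    conv_lhs => rw [← hu]
    rfl
  calc v u t = Real.exp (c * |t|) • u t := rfl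
    _ = (Real.exp (c * |t|) * Real.exp (-(c * |t|))) • (y₀ + I u t) := by rw [hut, smul_smul]
    _ = _ := by rw [← Real.exp_add]; simp [hI]

end Existence

/-- A two-sided Grönwall inequality with an integrable kernel. -/
theorem exists_gronwall_const {l : ℝ → ℝ} (hl : Integrable l) (hl0 : ∀ t, 0 ≤ l t)
    {T₁ T₂ : ℝ} (hT₁ : T₁ ≤ 0) (hT₂ : 0 ≤ T₂) :
    ∃ C : ℝ, 0 < C ∧ ∀ (d : ℝ → ℝ) (η : ℝ), 0 ≤ η → ContinuousOn d (Icc T₁ T₂) →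
      (∀ t ∈ Icc T₁ T₂, d t ≤ η + ∫ s in Ι 0 t, l s * d s) → ∀ t ∈ Icc T₁ T₂, d t ≤ C * η := by
  obtain ⟨c, hc, hweight⟩ := exists_exp_weight hl
  refine ⟨2 * Real.exp (c * max (-T₁) T₂), by positivity, fun d η hη hd hle => ?_⟩
  have hdc : ContinuousOn (fun t => Real.exp (-(c * |t|)) * d t) (Icc T₁ T₂) :=
    (Continuous.continuousOn (by fun_prop)).mul hd
  obtain ⟨t₀, ht₀, hmax⟩ := isCompact_Icc.exists_isMaxOn ⟨0, hT₁, hT₂⟩ hdc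
  set D := Real.exp (-(c * |t₀|)) * d t₀ with hD
  have hexp : ∀ t, Real.exp (c * |t|) * Real.exp (-(c * |t|)) = 1 := fun t => by
    rw [← Real.exp_add]; simp
  have hdD : ∀ t ∈ Icc T₁ T₂, d t ≤ Real.exp (c * |t|) * D := fun t ht => by
    calc d t = Real.exp (c * |t|) * (Real.exp (-(c * |t|)) * d t) := by
          rw [← mul_assoc, hexp, one_mul]
      _ ≤ _ := by gcongr; exact hmax ht
  have hbound : D ≤ 2 * η := by
    by_cases hD0 : D ≤ 0
    · linarith
    have hD0 : 0 < D := not_le.1 hD0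
    have hsub : uIcc 0 t₀ ⊆ Icc T₁ T₂ := uIcc_subset_Icc ⟨hT₁, hT₂⟩ ht₀
    have hint : ∫ s in Ι 0 t₀, l s * d s ≤ Real.exp (c * |t₀|) / 2 * D := by
      calc _ ≤ ∫ s in Ι 0 t₀, l s * Real.exp (c * |s|) * D := by
            refine setIntegral_mono_on ((hl.integrableOn.mul_continuousOn (hd.mono hsub)
              isCompact_uIcc).mono_set uIoc_subset_uIcc)
              ((hl.integrableOn_uIoc_mul (by fun_prop) 0 t₀).mul_const _) measurableSet_uIoc ?_
            intro s hs
            rw [mul_assoc]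
            exact mul_le_mul_of_nonneg_left (hdD s (hsub (uIoc_subset_uIcc hs))) (hl0 s)
        _ = (∫ s in Ι 0 t₀, l s * Real.exp (c * |s|)) * D := integral_mul_const _ _
        _ ≤ _ := by gcongr; exact hweight t₀
    have hone : Real.exp (-(c * |t₀|)) ≤ 1 := Real.exp_le_one_iff.2 (by
      have := mul_nonneg hc.le (abs_nonneg t₀)
      linarith)
    have : D ≤ η + D / 2 := by
      calc D ≤ Real.exp (-(c * |t₀|)) * (η + Real.exp (c * |t₀|) / 2 * D) := by
            rw [hD]
            gcongr
            exact (hle t₀ ht₀).trans (by gcongr)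
        _ = Real.exp (-(c * |t₀|)) * η
            + Real.exp (c * |t₀|) * Real.exp (-(c * |t₀|)) / 2 * D := by ring
        _ ≤ 1 * η + D / 2 := by
            rw [hexp]
            have : Real.exp (-(c * |t₀|)) * η ≤ 1 * η := by gcongr
            linarith
        _ = _ := by ring
    linarith
  intro t ht
  have habs : |t| ≤ max (-T₁) T₂ := abs_le.2
    ⟨by linarith [le_max_left (-T₁) T₂, ht.1], ht.2.trans (le_max_right _ _)⟩
  calc d t ≤ Real.exp (c * |t|) * D := hdD t ht
    _ ≤ Real.exp (c * |t|) * (2 * η) := by gcongr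
    _ ≤ Real.exp (c * max (-T₁) T₂) * (2 * η) := by gcongr
    _ = _ := by ring

section OptimalBound

variable {N : ℕ} {f : ℝ → Euc N → Euc N}

theorem mOpt_nonneg (f : ℝ → Euc N → Euc N) (j : ℕ) (t : ℝ) : 0 ≤ mOpt f j t :=
  Real.sSup_nonneg (by rintro _ ⟨x, -, rfl⟩; exact norm_nonneg _)

theorem IsCara.ae_bddAbove (hf : IsCara f) (j : ℕ) : ∃ m : ℝ → ℝ, LocInt m ∧
    ∀ᵐ t : ℝ, m t ∈ upperBounds {v : ℝ | ∃ x : Euc N, ‖x‖ ≤ (j : ℝ) ∧ v = ‖f t x‖} := by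
  obtain ⟨m, -, hm, hfm⟩ := hf.2 _ (isCompact_closedBall (0 : Euc N) j)
  refine ⟨m, hm, hfm.mono fun t ht => ?_⟩
  rintro _ ⟨x, hx, rfl⟩
  exact ht x (by simpa using hx)

theorem IsCara.ae_norm_le_mOpt (hf : IsCara f) (j : ℕ) :
    ∀ᵐ t : ℝ, ∀ x, ‖x‖ ≤ (j : ℝ) → ‖f t x‖ ≤ mOpt f j t := by
  obtain ⟨m, -, hm⟩ := hf.ae_bddAbove j
  filter_upwards [hm] with t ht x hx
  exact le_csSup ⟨_, ht⟩ ⟨x, hx, rfl⟩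

theorem IsLC.aemeasurable_mOpt (hf : IsLC f) (j : ℕ) : AEMeasurable (mOpt f j) := by
  obtain ⟨m, -, hm⟩ := hf.1.ae_bddAbove j
  obtain ⟨l, -, hl⟩ := hf.2 _ (isCompact_closedBall (0 : Euc N) j)
  have : Nonempty (Metric.closedBall (0 : Euc N) j) :=
    (Metric.nonempty_closedBall.2 j.cast_nonneg).to_subtype
  set d := TopologicalSpace.denseSeq (Metric.closedBall (0 : Euc N) j)
  have hd : ∀ k, ‖(d k : Euc N)‖ ≤ j := fun k =>
    mem_closedBall_zero_iff.1 (d k).2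
  refine ⟨fun t => ⨆ k, ‖f t (d k)‖, Measurable.iSup fun k =>
    (hf.1.1.measurable.comp (measurable_id.prodMk measurable_const)).norm, ?_⟩
  filter_upwards [hm, hl] with t htm htl
  have hbdd : BddAbove (range fun k => ‖f t (d k)‖) :=
    ⟨m t, by rintro _ ⟨k, rfl⟩; exact htm ⟨_, hd k, rfl⟩⟩
  have hcont : Continuous fun x : Metric.closedBall (0 : Euc N) j => f t x :=
    (LipschitzWith.of_dist_le_mul (K := ‖l t‖₊) fun x y => by
      rw [dist_eq_norm, Subtype.dist_eq, dist_eq_norm]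
      refine (htl x x.2 y y.2).trans ?_
      gcongr
      exact le_abs_self _).continuous
  refine le_antisymm (csSup_le ⟨_, d 0, hd 0, rfl⟩ ?_)
    (ciSup_le fun k => le_csSup ⟨_, htm⟩ ⟨_, hd k, rfl⟩)
  rintro _ ⟨x, hx, rfl⟩
  exact (TopologicalSpace.denseRange_denseSeq (Metric.closedBall (0 : Euc N) j)).induction_on
    (p := fun x => ‖f t x‖ ≤ ⨆ k, ‖f t (d k)‖) ⟨x, by simpa using hx⟩
    (isClosed_le hcont.norm continuous_const) (fun k => le_ciSup hbdd k)

theorem IsLC.locInt_mOpt (hf : IsLC f) (j : ℕ) : LocInt (mOpt f j) := fun a b => by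
  obtain ⟨m, hm, hfm⟩ := hf.1.ae_bddAbove j
  refine (hm a b).mono' (hf.aemeasurable_mOpt j).aestronglyMeasurable.restrict
    (ae_restrict_of_ae (hfm.mono fun t ht => ?_))
  rw [Real.norm_of_nonneg (mOpt_nonneg f j t)]
  exact csSup_le ⟨_, 0, by simp, rfl⟩ ht

theorem LocInt.intervalIntegrable {m : ℝ → ℝ} (hm : LocInt m) (a b : ℝ) :
    IntervalIntegrable m volume a b :=
  IntegrableOn.intervalIntegrable (hm (min a b) (max a b))

theorem LocInt.setIntegral_Icc_le_natCast {φ : ℝ → ℝ} (hφ : LocInt φ) {r δ : ℝ} (hδ : 0 < δ)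
    (h : ∀ s t : ℝ, -r ≤ s → s ≤ t → t ≤ r → t - s < δ → ∫ u in Icc s t, φ u < 1) (k : ℕ) :
    ∀ s t : ℝ, -r ≤ s → s ≤ t → t ≤ r → t - s ≤ k * (δ / 2) → ∫ u in Icc s t, φ u ≤ k := by
  induction k with
  | zero =>
    intro s t _ hst _ hk
    obtain rfl : s = t := le_antisymm hst (by simpa using hk)
    simp
  | succ k ih =>
    intro s t hs hst ht hk
    push_cast at hk ⊢
    set c := max s (t - δ / 2) with hc
    have hsc : s ≤ c := le_max_left _ _
    have hct : c ≤ t := max_le hst (by linarith)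
    have hsum : ∫ u in Icc s t, φ u = (∫ u in Icc s c, φ u) + ∫ u in Icc c t, φ u := by
      rw [integral_Icc_eq_integral_Ioc, integral_Icc_eq_integral_Ioc, integral_Icc_eq_integral_Ioc,
        ← intervalIntegral.integral_of_le hsc, ← intervalIntegral.integral_of_le hct,
        ← intervalIntegral.integral_of_le hst, intervalIntegral.integral_add_adjacent_intervals
          (hφ.intervalIntegrable _ _) (hφ.intervalIntegrable _ _)]
    have h₁ := ih s c hs hsc (hct.trans ht) (by
      rw [sub_le_iff_le_add]
      refine max_le ?_ (by linarith)
      have : 0 ≤ (k : ℝ) * (δ / 2) := by positivity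
      linarith)
    have h₂ := h c t (hs.trans hsc) hct ht (by linarith [le_max_right s (t - δ / 2)])
    linarith

end OptimalBound

section Moduli

variable {N : ℕ} {E : Set (ℝ → Euc N → Euc N)} {Θ : SuitableModuli}

theorem setIntegral_mOpt_le_modulus (hE : ∀ f ∈ E, IsLC f)
    (hequi : ∀ j : ℕ, ∀ r > (0:ℝ), ∀ ε > (0:ℝ), ∃ δ > (0:ℝ), ∀ f ∈ E, ∀ s t : ℝ,
      -r ≤ s → s ≤ t → t ≤ r → t - s < δ → ∫ u in Icc s t, mOpt f j u < ε)
    (hΘ : ∀ (j : ℕ) (q₁ q₂ : ℚ) (s : ℝ), 0 ≤ s →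
      Θ.θ j q₁ q₂ s = sSup {v : ℝ | ∃ t ∈ Icc (q₁:ℝ) (q₂:ℝ), ∃ f ∈ E,
        v = ∫ u in Icc t (t + s), mOpt f j u})
    {h : ℝ → Euc N → Euc N} (hh : h ∈ E) (j : ℕ) {q₁ q₂ : ℚ} {s t : ℝ}
    (hs : s ∈ Icc (q₁ : ℝ) q₂) (hst : s ≤ t) :
    ∫ u in Icc s t, mOpt h j u ≤ Θ.θ j q₁ q₂ (t - s) := by
  rw [hΘ j q₁ q₂ (t - s) (by linarith)]
  obtain ⟨δ, hδ, hsmall⟩ := hequi j (|(q₁ : ℝ)| + |(q₂ : ℝ)| + (t - s) + 1)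
    (by have : 0 ≤ t - s := by linarith
        positivity) 1 one_pos
  obtain ⟨k, hk⟩ := exists_nat_ge ((t - s) / (δ / 2))
  refine le_csSup ⟨k, ?_⟩ ⟨s, hs, h, hh, by rw [add_sub_cancel]⟩
  rintro _ ⟨a, ha, f, hf, rfl⟩
  refine ((hE f hf).locInt_mOpt j).setIntegral_Icc_le_natCast hδ (hsmall f hf) k _ _ ?_ ?_ ?_ ?_
  · have := neg_abs_le (q₁ : ℝ)
    have := abs_nonneg (q₂ : ℝ)
    linarith [ha.1]
  · linarith
  · have := le_abs_self (q₂ : ℝ)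
    have := abs_nonneg (q₁ : ℝ)
    linarith [ha.2]
  · rw [add_sub_cancel_left]
    exact (div_le_iff₀ (by positivity)).1 hk

end Moduli

section Truncation

variable {N : ℕ} {f : ℝ → Euc N → Euc N}

theorem IsCara.integrableOn_comp (hf : IsCara f) {j : ℕ} {z : ℝ → Euc N} (hz : Continuous z)
    (hzj : ∀ t, ‖z t‖ ≤ j) (a b : ℝ) : IntegrableOn (fun s => f s (z s)) (Icc a b) := by
  obtain ⟨m, -, hm, hfm⟩ := hf.2 _ (isCompact_closedBall (0 : Euc N) j)
  exact (hm a b).mono' (aestronglyMeasurable_comp_graph hf.1 hz _)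
    (ae_restrict_of_ae (hfm.mono fun t ht => ht _ (by simpa using hzj t)))

theorem IsCara.intervalIntegrable_comp (hf : IsCara f) {j : ℕ} {z : ℝ → Euc N}
    (hz : Continuous z) (hzj : ∀ t, ‖z t‖ ≤ j) (a b : ℝ) :
    IntervalIntegrable (fun s => f s (z s)) volume a b :=
  IntegrableOn.intervalIntegrable (hf.integrableOn_comp hz hzj (min a b) (max a b))

theorem IsLC.exists_truncated_solution (hf : IsLC f) {j : ℕ} {P : Euc N → Euc N}
    (hPj : ∀ x, ‖P x‖ ≤ (j : ℝ)) (hP : ∀ x y, ‖P x - P y‖ ≤ ‖x - y‖) {a b : ℝ}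
    (ha : a ≤ 0) (hb : 0 ≤ b) (y₀ : Euc N) :
    ∃ y : ℝ → Euc N, Continuous y ∧
      ∀ t ∈ Icc a b, y t = y₀ + ∫ s in (0 : ℝ)..t, f s (P (y s)) := by
  obtain ⟨m, hm0, hm, hfm⟩ := hf.1.2 _ (isCompact_closedBall (0 : Euc N) j)
  obtain ⟨l, hl, hfl⟩ := hf.2 _ (isCompact_closedBall (0 : Euc N) j)
  have hPK : ∀ x, P x ∈ Metric.closedBall (0 : Euc N) j := fun x => by simpa using hPj x
  have hPc : Continuous P := (LipschitzWith.of_dist_le_mul (K := 1) fun x y => by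
    simpa [dist_eq_norm] using hP x y).continuous
  obtain ⟨y, hy, hsol⟩ := exists_forall_eq_add_integral
    (g := fun t x => (Icc a b).indicator (fun s => f s (P x)) t)
    (m := (Icc a b).indicator m) (l := (Icc a b).indicator fun t => |l t|)
    (((hf.1.1.comp_measurable (measurable_fst.prodMk (hPc.measurable.comp measurable_snd))
      ).indicator (measurableSet_Icc.preimage measurable_fst)))
    ((integrable_indicator_iff measurableSet_Icc).2 (hm a b))
    ((integrable_indicator_iff measurableSet_Icc).2 (hl a b).abs)
    (fun t => indicator_nonneg (fun _ _ => abs_nonneg _) t)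
    (hfm.mono fun t ht x => by
      by_cases hmem : t ∈ Icc a b
      · simpa [hmem] using ht _ (hPK x)
      · simp [hmem])
    (hfl.mono fun t ht x y => by
      by_cases hmem : t ∈ Icc a b
      · simp only [hmem, indicator_of_mem]
        exact (ht _ (hPK x) _ (hPK y)).trans (mul_le_mul (le_abs_self _) (hP x y)
          (norm_nonneg _) (abs_nonneg _))
      · simp [hmem]) y₀
  refine ⟨y, hy, fun t ht => ?_⟩
  rw [hsol t]
  congr 1
  refine intervalIntegral.integral_congr fun s hs => ?_
  exact indicator_of_mem (uIcc_subset_Icc ⟨ha, hb⟩ ht hs) _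

end Truncation

section ContinuousDependence

variable {N : ℕ} {E : Set (ℝ → Euc N → Euc N)} {Θ : SuitableModuli}

theorem inK_retraction_solution (hE : ∀ f ∈ E, IsLC f)
    (hequi : ∀ j : ℕ, ∀ r > (0:ℝ), ∀ ε > (0:ℝ), ∃ δ > (0:ℝ), ∀ f ∈ E, ∀ s t : ℝ,
      -r ≤ s → s ≤ t → t ≤ r → t - s < δ → ∫ u in Icc s t, mOpt f j u < ε)
    (hΘ : ∀ (j : ℕ) (q₁ q₂ : ℚ) (s : ℝ), 0 ≤ s →
      Θ.θ j q₁ q₂ s = sSup {v : ℝ | ∃ t ∈ Icc (q₁:ℝ) (q₂:ℝ), ∃ f ∈ E,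
        v = ∫ u in Icc t (t + s), mOpt f j u})
    {h : ℝ → Euc N → Euc N} (hh : h ∈ E) {j : ℕ} {P : Euc N → Euc N}
    (hPj : ∀ x, ‖P x‖ ≤ (j : ℝ)) (hP : ∀ x y, ‖P x - P y‖ ≤ ‖x - y‖)
    {a b : ℝ} {y : ℝ → Euc N} {y₀ : Euc N} (hPy : Continuous fun t => P (y t))
    (hsol : ∀ t ∈ Icc a b, y t = y₀ + ∫ s in (0 : ℝ)..t, h s (P (y s)))
    {q₁ q₂ : ℚ} (hq₁ : a ≤ q₁) (hq₂ : (q₂ : ℝ) ≤ b) :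
    inK Θ j q₁ q₂ fun t => P (y t) := by
  have hint := (hE h hh).1.intervalIntegrable_comp hPy fun t => hPj (y t)
  have key : ∀ s ∈ Icc (q₁ : ℝ) q₂, ∀ t ∈ Icc (q₁ : ℝ) q₂, s ≤ t →
      ‖P (y t) - P (y s)‖ ≤ Θ.θ j q₁ q₂ (t - s) := by
    intro s hs t ht hst
    have hdiff : y t - y s = ∫ u in s..t, h u (P (y u)) := by
      rw [hsol t ⟨hq₁.trans ht.1, ht.2.trans hq₂⟩, hsol s ⟨hq₁.trans hs.1, hs.2.trans hq₂⟩,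
        add_sub_add_left_eq_sub, intervalIntegral.integral_interval_sub_left (hint _ _) (hint _ _)]
    calc ‖P (y t) - P (y s)‖ ≤ ‖y t - y s‖ := hP _ _
      _ ≤ ∫ u in s..t, mOpt h j u := by
        rw [hdiff]
        exact intervalIntegral.norm_integral_le_of_norm_le hst
          (((hE h hh).1.ae_norm_le_mOpt j).mono fun u hu _ => hu _ (hPj _))
          (((hE h hh).locInt_mOpt j).intervalIntegrable s t)
      _ = ∫ u in Icc s t, mOpt h j u := by
        rw [intervalIntegral.integral_of_le hst, integral_Icc_eq_integral_Ioc]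
      _ ≤ _ := setIntegral_mOpt_le_modulus hE hequi hΘ hh j hs hst
  refine ⟨hPy.continuousOn, fun t _ => hPj _, fun t ht s hs => ?_⟩
  rcases le_total s t with hst | hst
  · rw [abs_of_nonneg (sub_nonneg.2 hst)]
    exact key s hs t ht hst
  · rw [abs_sub_comm, abs_of_nonneg (sub_nonneg.2 hst), norm_sub_rev]
    exact key t ht s hs hst

theorem LocInt.exists_setIntegral_lt {m : ℝ → ℝ} (hm : LocInt m) (r : ℝ) {ε : ℝ} (hε : 0 < ε) :
    ∃ δ > (0 : ℝ), ∀ s t : ℝ, -r ≤ s → s ≤ t → t ≤ r → t - s < δ → ∫ u in Icc s t, m u < ε := by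
  have hcont : Continuous fun t => ∫ u in (0 : ℝ)..t, m u :=
    intervalIntegral.continuous_primitive hm.intervalIntegrable 0
  obtain ⟨δ, hδ, h⟩ := Metric.uniformContinuousOn_iff.1
    ((isCompact_Icc (a := -r) (b := r)).uniformContinuousOn_of_continuous hcont.continuousOn) ε hε
  refine ⟨δ, hδ, fun s t hs hst ht hd => ?_⟩
  have h' := h t ⟨hs.trans hst, ht⟩ s ⟨hs, hst.trans ht⟩
    (by rwa [Real.dist_eq, abs_of_nonneg (sub_nonneg.2 hst)])
  rw [Real.dist_eq, intervalIntegral.integral_interval_sub_left (hm.intervalIntegrable _ _)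
    (hm.intervalIntegrable _ _)] at h'
  rw [integral_Icc_eq_integral_Ioc, ← intervalIntegral.integral_of_le hst]
  exact (le_abs_self _).trans_lt h'

theorem SigmaTendsto.eventually_intervalIntegral_lt {fs : ℕ → ℝ → Euc N → Euc N}
    {f : ℝ → Euc N → Euc N} (hconv : SigmaTendsto Θ fs f) (j : ℕ) (q₁ q₂ : ℚ) {ε : ℝ}
    (hε : 0 < ε) :
    ∀ᶠ n in atTop, ∀ z : ℝ → Euc N, inK Θ j (min q₁ q₂) (max q₁ q₂) z →
      ‖∫ s in (q₁ : ℝ)..q₂, (fs n s (z s) - f s (z s))‖ < ε := by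
  filter_upwards [hconv j (min q₁ q₂) (max q₁ q₂) ε hε] with n hn z hz
  have h := hn z hz
  rwa [intervalIntegral.norm_intervalIntegral_eq, uIoc, ← integral_Icc_eq_integral_Ioc,
    ← Rat.cast_min, ← Rat.cast_max]

/-- `σ_Θ` convergence is uniform in the upper limit of integration. -/
theorem SigmaTendsto.eventually_forall_norm_integral_le (hE : ∀ f ∈ E, IsLC f)
    (hequi : ∀ j : ℕ, ∀ r > (0:ℝ), ∀ ε > (0:ℝ), ∃ δ > (0:ℝ), ∀ f ∈ E, ∀ s t : ℝ,
      -r ≤ s → s ≤ t → t ≤ r → t - s < δ → ∫ u in Icc s t, mOpt f j u < ε)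
    {fs : ℕ → ℝ → Euc N → Euc N} (hfs : ∀ n, fs n ∈ E)
    {f : ℝ → Euc N → Euc N} (hf : IsCara f) (hconv : SigmaTendsto Θ fs f)
    (j R : ℕ) (hR : 0 < R) {η : ℝ} (hη : 0 < η) :
    ∀ᶠ n in atTop, ∀ z : ℝ → Euc N, Continuous z → (∀ t, ‖z t‖ ≤ j) →
      (∀ q₁ q₂ : ℚ, -(R : ℝ) ≤ q₁ → (q₂ : ℝ) ≤ R → inK Θ j q₁ q₂ z) →
      ∀ t ∈ Icc (-(R : ℝ)) R, ‖∫ s in (0 : ℝ)..t, (fs n s (z s) - f s (z s))‖ ≤ η := by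
  obtain ⟨m, -, hm, hfm⟩ := hf.2 _ (isCompact_closedBall (0 : Euc N) j)
  obtain ⟨δ₁, hδ₁, h₁⟩ := hequi j R (by exact_mod_cast hR) (η / 3) (by positivity)
  obtain ⟨δ₂, hδ₂, h₂⟩ := hm.exists_setIntegral_lt R (show 0 < η / 3 by positivity)
  obtain ⟨k, hk⟩ := exists_nat_one_div_lt (lt_min hδ₁ hδ₂)
  have hk0 : (0 : ℝ) < (k : ℝ) + 1 := by positivity
  have hgrid : ∀ᶠ n in atTop, ∀ p ∈ Finset.Icc (-((R : ℤ) * (k + 1))) (R * (k + 1)),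
      ∀ z : ℝ → Euc N, inK Θ j (min 0 ((p : ℚ) / (k + 1))) (max 0 ((p : ℚ) / (k + 1))) z →
        ‖∫ s in ((0 : ℚ) : ℝ)..((p : ℚ) / (k + 1) : ℚ), (fs n s (z s) - f s (z s))‖ < η / 3 :=
    (Finset.eventually_all _).2 fun p _ =>
      hconv.eventually_intervalIntegral_lt j 0 _ (by positivity)
  filter_upwards [hgrid] with n hn z hz hzj hzK t ht
  set p : ℤ := ⌊t * (k + 1)⌋ with hp
  set q : ℚ := (p : ℚ) / (k + 1) with hq
  have hqr : (q : ℝ) = (p : ℝ) / (k + 1) := by rw [hq]; push_cast; rfl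
  have hp_le : -((R : ℤ) * (k + 1)) ≤ p := by
    rw [hp, Int.le_floor]
    push_cast
    nlinarith [ht.1]
  have hqt : (q : ℝ) ≤ t := by
    rw [hqr, div_le_iff₀ hk0]
    exact Int.floor_le _
  have hRq : -(R : ℝ) ≤ q := by
    rw [hqr, le_div_iff₀ hk0]
    have : ((-((R : ℤ) * (k + 1)) : ℤ) : ℝ) ≤ p := by exact_mod_cast hp_le
    push_cast at this
    linarith
  have hp_ge : p ≤ R * (k + 1) := by
    have : (p : ℝ) ≤ ((R * (k + 1) : ℤ) : ℝ) := by
      push_cast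
      have := (Int.floor_le (t * ((k : ℝ) + 1)))
      nlinarith [ht.2]
    exact_mod_cast this
  have htq : t - q < 1 / ((k : ℝ) + 1) := by
    have := Int.lt_floor_add_one (t * ((k : ℝ) + 1))
    rw [hqr, lt_div_iff₀ hk0, sub_mul, div_mul_cancel₀ _ hk0.ne']
    linarith
  have hRR : (0 : ℝ) ≤ R := R.cast_nonneg
  have hintn := (hE _ (hfs n)).1.intervalIntegrable_comp hz hzj
  have hint := hf.intervalIntegrable_comp hz hzj
  have hbig := hn p (Finset.mem_Icc.2 ⟨hp_le, hp_ge⟩) z (hzK _ _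
    (by push_cast; exact le_min (by linarith) (by rw [← hqr]; exact hRq))
    (by push_cast; exact max_le hRR (by rw [← hqr]; exact hqt.trans ht.2)))
  rw [← hq, Rat.cast_zero] at hbig
  have hsmall₁ : ‖∫ s in (q : ℝ)..t, fs n s (z s)‖ < η / 3 := by
    refine lt_of_le_of_lt (intervalIntegral.norm_integral_le_of_norm_le hqt
      (((hE _ (hfs n)).1.ae_norm_le_mOpt j).mono fun u hu _ => hu _ (hzj _))
      (((hE _ (hfs n)).locInt_mOpt j).intervalIntegrable _ _)) ?_
    rw [intervalIntegral.integral_of_le hqt, ← integral_Icc_eq_integral_Ioc]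
    exact h₁ _ (hfs n) _ _ hRq hqt ht.2 (htq.trans (hk.trans_le (min_le_left _ _)))
  have hsmall₂ : ‖∫ s in (q : ℝ)..t, f s (z s)‖ < η / 3 := by
    refine lt_of_le_of_lt (intervalIntegral.norm_integral_le_of_norm_le hqt
      (hfm.mono fun u hu _ => hu _ (by simpa using hzj u)) (hm.intervalIntegrable _ _)) ?_
    rw [intervalIntegral.integral_of_le hqt, ← integral_Icc_eq_integral_Ioc]
    exact h₂ _ _ hRq hqt ht.2 (htq.trans (hk.trans_le (min_le_right _ _)))
  rw [← intervalIntegral.integral_add_adjacent_intervals (b := (q : ℝ))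
    ((hintn _ _).sub (hint _ _)) ((hintn _ _).sub (hint _ _)),
    intervalIntegral.integral_sub (hintn q t) (hint q t)]
  refine (norm_add_le _ _).trans ?_
  have := norm_sub_le (∫ s in (q : ℝ)..t, fs n s (z s)) (∫ s in (q : ℝ)..t, f s (z s))
  linarith

theorem continuous_dependence_of_continuous (hE : ∀ f ∈ E, IsLC f)
    (hequi : ∀ j : ℕ, ∀ r > (0:ℝ), ∀ ε > (0:ℝ), ∃ δ > (0:ℝ), ∀ f ∈ E, ∀ s t : ℝ,
      -r ≤ s → s ≤ t → t ≤ r → t - s < δ → ∫ u in Icc s t, mOpt f j u < ε)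
    (hΘ : ∀ (j : ℕ) (q₁ q₂ : ℚ) (s : ℝ), 0 ≤ s →
      Θ.θ j q₁ q₂ s = sSup {v : ℝ | ∃ t ∈ Icc (q₁:ℝ) (q₂:ℝ), ∃ f ∈ E,
        v = ∫ u in Icc t (t + s), mOpt f j u})
    {fs : ℕ → ℝ → Euc N → Euc N} (hfs : ∀ n, fs n ∈ E)
    {f : ℝ → Euc N → Euc N} (hf : IsLC f) (hconv : SigmaTendsto Θ fs f)
    {x₀s : ℕ → Euc N} {x₀ : Euc N} (hx₀ : Tendsto x₀s atTop (𝓝 x₀))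
    {x : ℝ → Euc N} {T₁ T₂ : ℝ} (hT₁ : T₁ ≤ 0) (hT₂ : 0 ≤ T₂) (hxc : Continuous x)
    (hxsol : ∀ t ∈ Icc T₁ T₂, x t = x₀ + ∫ s in (0:ℝ)..t, f s (x s)) {ε : ℝ} (hε : 0 < ε) :
    ∀ᶠ n in atTop, ∃ y : ℝ → Euc N, Continuous y ∧
      (∀ t ∈ Icc T₁ T₂, y t = x₀s n + ∫ s in (0:ℝ)..t, fs n s (y s)) ∧
      ∀ t ∈ Icc T₁ T₂, ‖y t - x t‖ ≤ ε := by
  obtain ⟨B, hB⟩ := (isCompact_Icc (a := T₁) (b := T₂)).exists_bound_of_continuousOn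
    hxc.continuousOn
  obtain ⟨j, hj⟩ := exists_nat_ge (B + ε)
  obtain ⟨P, hPj, hP, hPid⟩ :=
    exists_nonexpansive_retraction_ball (G := Euc N) (r := j) j.cast_nonneg
  have hPc : Continuous P := (LipschitzWith.of_dist_le_mul (K := 1) fun x y => by
    simpa [dist_eq_norm] using hP x y).continuous
  have hPx : ∀ t ∈ Icc T₁ T₂, P (x t) = x t := fun t ht => hPid _ (by linarith [hB t ht])
  obtain ⟨R, hR⟩ := exists_nat_gt (max (-T₁) T₂)
  have hR₁ : -(R : ℝ) ≤ T₁ := by linarith [le_max_left (-T₁) T₂]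
  have hR₂ : T₂ ≤ R := by linarith [le_max_right (-T₁) T₂]
  have hR0 : 0 < R := by
    have : (0 : ℝ) < R := (hT₂.trans (le_max_right _ _)).trans_lt hR
    exact_mod_cast this
  have hsubR : Icc T₁ T₂ ⊆ Icc (-(R : ℝ)) R := Icc_subset_Icc hR₁ hR₂
  obtain ⟨l, hl, hfl⟩ := hf.2 _ (isCompact_closedBall (0 : Euc N) j)
  set L : ℝ → ℝ := (Icc T₁ T₂).indicator fun t => |l t| with hL
  have hLint : Integrable L := (integrable_indicator_iff measurableSet_Icc).2 (hl _ _).abs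
  obtain ⟨C, hC, hgron⟩ := exists_gronwall_const hLint
    (fun t => indicator_nonneg (fun _ _ => abs_nonneg _) t) hT₁ hT₂
  have hη : 0 < ε / (2 * C) := by positivity
  have hx₀' : ∀ᶠ n in atTop, ‖x₀s n - x₀‖ ≤ ε / (2 * C) := by
    filter_upwards [Metric.tendsto_nhds.1 hx₀ _ hη] with n hn
    rw [← dist_eq_norm]
    exact hn.le
  filter_upwards [hx₀', hconv.eventually_forall_norm_integral_le hE hequi hfs hf.1 j R hR0 hη]
    with n hn₀ hn
  obtain ⟨y, hy, hysol⟩ := (hE _ (hfs n)).exists_truncated_solution hPj hP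
    (by linarith : -(R : ℝ) ≤ 0) (by positivity : (0 : ℝ) ≤ R) (x₀s n)
  have hPy : Continuous fun t => P (y t) := hPc.comp hy
  have hclose : ∀ t ∈ Icc T₁ T₂, ‖y t - x t‖ ≤ ε := by
    have h := hgron (fun t => ‖y t - x t‖) (ε / C) (by positivity)
      (hy.sub hxc).norm.continuousOn fun t ht => ?_
    · intro t ht
      exact (h t ht).trans_eq (by field_simp)
    have hsub : Ι 0 t ⊆ Icc T₁ T₂ :=
      uIoc_subset_uIcc.trans (uIcc_subset_Icc ⟨hT₁, hT₂⟩ ht)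
    have hi₁ := (hE _ (hfs n)).1.intervalIntegrable_comp hPy (fun t => hPj (y t)) 0 t
    have hi₂ := hf.1.intervalIntegrable_comp hPy (fun t => hPj (y t)) 0 t
    have hi₃ := hf.1.intervalIntegrable_comp (z := fun t => P (x t)) (hPc.comp hxc)
      (fun t => hPj (x t)) 0 t
    have hxt : x t = x₀ + ∫ s in (0 : ℝ)..t, f s (P (x s)) := by
      rw [hxsol t ht]
      congr 1
      refine intervalIntegral.integral_congr fun s hs => ?_
      simp only [hPx s (uIcc_subset_Icc ⟨hT₁, hT₂⟩ ht hs)]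
    have hdecomp : y t - x t = (x₀s n - x₀)
        + (∫ s in (0 : ℝ)..t, (fs n s (P (y s)) - f s (P (y s))))
        + ∫ s in (0 : ℝ)..t, (f s (P (y s)) - f s (P (x s))) := by
      rw [hysol t (hsubR ht), hxt, intervalIntegral.integral_sub hi₁ hi₂,
        intervalIntegral.integral_sub hi₂ hi₃]
      abel
    have hlast : ‖∫ s in (0 : ℝ)..t, (f s (P (y s)) - f s (P (x s)))‖
        ≤ ∫ s in Ι 0 t, L s * ‖y s - x s‖ := by
      refine intervalIntegral.norm_integral_le_integral_norm_uIoc.trans ?_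
      refine setIntegral_mono_on_ae (hi₂.sub hi₃).def'.norm
        (hLint.integrableOn_uIoc_mul (hy.sub hxc).norm 0 t) measurableSet_uIoc ?_
      filter_upwards [hfl] with s hs hst
      rw [hL, indicator_of_mem (hsub hst)]
      exact (hs _ (by simpa using hPj (y s)) _ (by simpa using hPj (x s))).trans
        (mul_le_mul (le_abs_self _) (hP _ _) (norm_nonneg _) (abs_nonneg _))
    have hmid := hn (fun t => P (y t)) hPy (fun t => hPj _) (fun q₁ q₂ hq₁ hq₂ =>
      inK_retraction_solution hE hequi hΘ (hfs n) hPj hP hPy hysol hq₁ hq₂) t (hsubR ht)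
    have hsum : ε / C = ε / (2 * C) + ε / (2 * C) := by field_simp; ring
    rw [hdecomp, hsum]
    exact (norm_add₃_le).trans (by gcongr)
  refine ⟨y, hy, fun t ht => ?_, hclose⟩
  rw [hysol t (hsubR ht)]
  congr 1
  refine intervalIntegral.integral_congr fun s hs => ?_
  have hs' := uIcc_subset_Icc ⟨hT₁, hT₂⟩ ht hs
  have hys : ‖y s‖ ≤ j := by
    have h₁ := hclose s hs'
    have h₂ := hB s hs'
    have h₃ := norm_le_norm_add_norm_sub (x s) (y s)
    rw [norm_sub_rev] at h₃
    linarith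
  simp only [hPid _ hys]

end ContinuousDependence

end Auxiliary

/-- continuous dependence of solutions on initial data and on the
vector field (for `σ_Θ` convergence with `Θ` built from the optimal m-bounds). -/
theorem stmt7 {N : ℕ} (E : Set (ℝ → Euc N → Euc N)) (hE : ∀ f ∈ E, IsLC f)
    (hequi : ∀ j : ℕ, ∀ r > (0:ℝ), ∀ ε > (0:ℝ), ∃ δ > (0:ℝ), ∀ f ∈ E, ∀ s t : ℝ,
      -r ≤ s → s ≤ t → t ≤ r → t - s < δ → ∫ u in Icc s t, mOpt f j u < ε)
    (Θ : SuitableModuli)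
    (hΘ : ∀ (j : ℕ) (q₁ q₂ : ℚ) (s : ℝ), 0 ≤ s →
      Θ.θ j q₁ q₂ s = sSup {v : ℝ | ∃ t ∈ Icc (q₁:ℝ) (q₂:ℝ), ∃ f ∈ E,
        v = ∫ u in Icc t (t + s), mOpt f j u})
    (fs : ℕ → ℝ → Euc N → Euc N) (hfs : ∀ n, fs n ∈ E)
    (f : ℝ → Euc N → Euc N) (hf : IsLC f)
    (hconv : SigmaTendsto Θ fs f)
    (x₀s : ℕ → Euc N) (x₀ : Euc N) (hx₀ : Tendsto x₀s atTop (𝓝 x₀))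
    (x : ℝ → Euc N) (T₁ T₂ : ℝ) (hT₁ : T₁ ≤ 0) (hT₂ : 0 ≤ T₂)
    (hxc : ContinuousOn x (Icc T₁ T₂))
    (hxsol : ∀ t ∈ Icc T₁ T₂, x t = x₀ + ∫ s in (0:ℝ)..t, f s (x s)) :
    ∀ ε > (0:ℝ), ∃ n₀ : ℕ, ∀ n ≥ n₀, ∃ xn : ℝ → Euc N,
      ContinuousOn xn (Icc T₁ T₂) ∧
      (∀ t ∈ Icc T₁ T₂, xn t = x₀s n + ∫ s in (0:ℝ)..t, fs n s (xn s)) ∧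
      ∀ t ∈ Icc T₁ T₂, ‖xn t - x t‖ ≤ ε := by
  intro ε hε
  have hT : T₁ ≤ T₂ := hT₁.trans hT₂
  obtain ⟨x', hx', heq⟩ : ∃ x' : ℝ → Euc N, Continuous x' ∧ ∀ t ∈ Icc T₁ T₂, x' t = x t :=
    ⟨IccExtend hT ((Icc T₁ T₂).domRestrict x), hxc.domRestrict.Icc_extend',
      fun t ht => IccExtend_of_mem hT _ ht⟩
  have hsol' : ∀ t ∈ Icc T₁ T₂, x' t = x₀ + ∫ s in (0:ℝ)..t, f s (x' s) := fun t ht => by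
    rw [heq t ht, hxsol t ht]
    congr 1
    refine intervalIntegral.integral_congr fun s hs => ?_
    simp only [heq s (uIcc_subset_Icc ⟨hT₁, hT₂⟩ ht hs)]
  obtain ⟨n₀, hn₀⟩ := eventually_atTop.1 (continuous_dependence_of_continuous hE hequi hΘ hfs hf
    hconv hx₀ hT₁ hT₂ hx' hsol' hε)
  refine ⟨n₀, fun n hn => ?_⟩
  obtain ⟨y, hy, hsol, hclose⟩ := hn₀ n hn
  exact ⟨y, hy.continuousOn, hsol, fun t ht => heq t ht ▸ hclose t ht⟩
end
end

section
/- Let A, Â : ℝ → ℝ^{N×N} have locally integrable entries, with fundamental matrix solutions Φ and Ψ respectively (so Φ(t) = I + ∫_0^t A(s)Φ(s) ds, Ψ(t) = I + ∫_0^t Â(s)Ψ(s) ds, and Φ(t), Ψ(t) are invertible for every t). Assume ẏ = A(t)y has exponential dichotomy on (−∞, 0] with projection P and constants K ≥ 1, α > 0, i.e. ‖Φ(t) P Φ(s)⁻¹‖ ≤ K e^{−α(t−s)} for all s ≤ t ≤ 0 and ‖Φ(t)(I − P)Φ(s)⁻¹‖ ≤ K e^{α(t−s)} for all t ≤ s ≤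 0. Suppose there is a sequence (r_n) with r_n → −∞ such that Φ(t + r_n)Φ(r_n)⁻¹ → Ψ(t) as n → ∞ for every t ∈ ℝ. Then there exists a projection P̂ (P̂² = P̂) such that ‖Ψ(t) P̂ Ψ(s)⁻¹‖ ≤ K e^{−α(t−s)} for all s ≤ t and ‖Ψ(t)(I − P̂)Ψ(s)⁻¹‖ ≤ K e^{α(t−s)} for all t ≤ s; that is, ẏ = Â(t)y has exponential dichotomy on all of ℝ with the same constants K and α. -/
open MeasureTheory Set Filter Topology
open scoped RealInnerProductSpace

noncomputable section

/-- In a complete normed ring, two-sided inverses of a convergent family converge to the inverse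
of the limit. -/
theorem tendsto_of_two_sided_inverses {ι R : Type*} [NormedRing R] [CompleteSpace R]
    {l : Filter ι} {f g : ι → R} {a b : R} (hf : Tendsto f l (𝓝 a))
    (hfg : ∀ i, f i * g i = 1) (hgf : ∀ i, g i * f i = 1) (hab : a * b = 1) (hba : b * a = 1) :
    Tendsto g l (𝓝 b) := by
  have hcont := (NormedRing.inverse_continuousAt (⟨a, b, hab, hba⟩ : Rˣ)).tendsto.comp hf
  have hb : Ring.inverse a = b := Ring.inverse_unit (⟨a, b, hab, hba⟩ : Rˣ)
  have hg : ∀ i, Ring.inverse (f i) = g i :=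
    fun i => Ring.inverse_unit (⟨f i, g i, hfg i, hgf i⟩ : Rˣ)
  simpa only [Function.comp_def, hg, hb] using hcont

/-- Exponential dichotomy on `(-∞, 0]` of an invertible family in a proper normed ring passes to
a dichotomy on `ℝ`, with the same constants, for any limit of its translates along times tending
to `-∞`. -/
theorem exists_dichotomy_of_tendsto_translates {R : Type*} [NormedRing R] [ProperSpace R]
    {Φ Φinv Ψ Ψinv : ℝ → R}
    (hΦ : ∀ t, Φ t * Φinv t = 1 ∧ Φinv t * Φ t = 1)
    (hΨ : ∀ t, Ψ t * Ψinv t = 1 ∧ Ψinv t * Ψ t = 1)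
    {P : R} (hP : P * P = P) {K α : ℝ}
    (hstable : ∀ s t : ℝ, s ≤ t → t ≤ 0 →
      ‖Φ t * (P * Φinv s)‖ ≤ K * Real.exp (-α * (t - s)))
    (hunstable : ∀ s t : ℝ, t ≤ s → s ≤ 0 →
      ‖Φ t * ((1 - P) * Φinv s)‖ ≤ K * Real.exp (α * (t - s)))
    {r : ℕ → ℝ} (hr : Tendsto r atTop atBot)
    (hlim : ∀ t, Tendsto (fun n => Φ (t + r n) * Φinv (r n)) atTop (𝓝 (Ψ t))) :
    ∃ Q : R, Q * Q = Q ∧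
      (∀ s t : ℝ, s ≤ t → ‖Ψ t * (Q * Ψinv s)‖ ≤ K * Real.exp (-α * (t - s))) ∧
      (∀ s t : ℝ, t ≤ s → ‖Ψ t * ((1 - Q) * Ψinv s)‖ ≤ K * Real.exp (α * (t - s))) := by
  have cancel : ∀ t x, Φinv t * (Φ t * x) = x := fun t x => by
    rw [← mul_assoc, (hΦ t).2, one_mul]
  have cancel' : ∀ t x, Φ t * (Φinv t * x) = x := fun t x => by
    rw [← mul_assoc, (hΦ t).1, one_mul]
  have hlim_inv : ∀ s, Tendsto (fun n => Φ (r n) * Φinv (s + r n)) atTop (𝓝 (Ψinv s)) := by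
    refine fun s => tendsto_of_two_sided_inverses (hlim s) (fun n => ?_) (fun n => ?_)
      (hΨ s).1 (hΨ s).2
    · rw [mul_assoc, cancel, (hΦ _).1]
    · rw [mul_assoc, cancel, (hΦ _).1]
  have hbdd : ∃ᶠ n in atTop, Φ (r n) * (P * Φinv (r n)) ∈ Metric.closedBall (0 : R) K := by
    refine Eventually.frequently ?_
    filter_upwards [hr.eventually_le_atBot 0] with n hn
    simpa using hstable (r n) (r n) le_rfl hn
  obtain ⟨Q, -, φ, hφ, hQ⟩ :=
    tendsto_subseq_of_frequently_bounded Metric.isBounded_closedBall hbdd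
  have hsub := hφ.tendsto_atTop
  have hnonpos : ∀ t, ∀ᶠ n in atTop, t + r (φ n) ≤ 0 := fun t =>
    (tendsto_atBot_add_const_left _ t (hr.comp hsub)).eventually_le_atBot 0
  refine ⟨Q, ?_, fun s t hst => ?_, fun s t hts => ?_⟩
  · refine tendsto_nhds_unique (hQ.mul hQ) (hQ.congr fun n => ?_)
    simp only [Function.comp_apply, mul_assoc, cancel]
    rw [← mul_assoc P P, hP]
  · refine le_of_tendsto
      (((hlim t).comp hsub).mul (hQ.mul ((hlim_inv s).comp hsub))).norm ?_
    filter_upwards [hnonpos t] with n hn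
    have h := hstable (s + r (φ n)) (t + r (φ n)) (by linarith) hn
    simpa only [Function.comp_apply, mul_assoc, cancel, add_sub_add_right_eq_sub] using h
  · refine le_of_tendsto
      (((hlim t).comp hsub).mul
        ((hQ.const_sub 1).mul ((hlim_inv s).comp hsub))).norm ?_
    filter_upwards [hnonpos s] with n hn
    have h := hunstable (s + r (φ n)) (t + r (φ n)) (by linarith) hn
    simpa only [Function.comp_apply, mul_assoc, sub_mul, mul_sub, one_mul, cancel, cancel',
      add_sub_add_right_eq_sub] using h

/-- propagation of the exponential dichotomy on `(−∞,0]` to a full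
dichotomy on `ℝ` for a limit of translated fundamental matrices. -/
theorem stmt9 {N : ℕ} (A Ahat : ℝ → (Euc N →L[ℝ] Euc N))
    (hA : ∀ a b : ℝ, IntervalIntegrable A volume a b)
    (hAhat : ∀ a b : ℝ, IntervalIntegrable Ahat volume a b)
    (Φ Φinv Ψ Ψinv : ℝ → (Euc N →L[ℝ] Euc N))
    (hΦ : ∀ t : ℝ, Φ t = ContinuousLinearMap.id ℝ (Euc N) + ∫ s in (0:ℝ)..t, (A s).comp (Φ s))
    (hΨ : ∀ t : ℝ, Ψ t = ContinuousLinearMap.id ℝ (Euc N) + ∫ s in (0:ℝ)..t, (Ahat s).comp (Ψ s))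
    (hΦinv : ∀ t : ℝ, (Φ t).comp (Φinv t) = ContinuousLinearMap.id ℝ (Euc N) ∧
      (Φinv t).comp (Φ t) = ContinuousLinearMap.id ℝ (Euc N))
    (hΨinv : ∀ t : ℝ, (Ψ t).comp (Ψinv t) = ContinuousLinearMap.id ℝ (Euc N) ∧
      (Ψinv t).comp (Ψ t) = ContinuousLinearMap.id ℝ (Euc N))
    (P : Euc N →L[ℝ] Euc N) (hP : P.comp P = P)
    (K α : ℝ) (hK : 1 ≤ K) (hα : 0 < α)
    (hdich₁ : ∀ s t : ℝ, s ≤ t → t ≤ 0 →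
      ‖(Φ t).comp (P.comp (Φinv s))‖ ≤ K * Real.exp (-α * (t - s)))
    (hdich₂ : ∀ s t : ℝ, t ≤ s → s ≤ 0 →
      ‖(Φ t).comp ((ContinuousLinearMap.id ℝ (Euc N) - P).comp (Φinv s))‖ ≤
        K * Real.exp (α * (t - s)))
    (r : ℕ → ℝ) (hr : Tendsto r atTop atBot)
    (hlim : ∀ t : ℝ, Tendsto (fun n => (Φ (t + r n)).comp (Φinv (r n))) atTop (𝓝 (Ψ t))) :
    ∃ Phat : Euc N →L[ℝ] Euc N, Phat.comp Phat = Phat ∧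
      (∀ s t : ℝ, s ≤ t →
        ‖(Ψ t).comp (Phat.comp (Ψinv s))‖ ≤ K * Real.exp (-α * (t - s))) ∧
      (∀ s t : ℝ, t ≤ s →
        ‖(Ψ t).comp ((ContinuousLinearMap.id ℝ (Euc N) - Phat).comp (Ψinv s))‖ ≤
          K * Real.exp (α * (t - s))) := by
  have : ProperSpace (Euc N →L[ℝ] Euc N) := FiniteDimensional.proper ℝ _
  exact exists_dichotomy_of_tendsto_translates hΦinv hΨinv hP hdich₁ hdich₂ hr hlim
end
end
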